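/- arXiv:2109.07952 — 3 statements merged into one kernel-verified Lean document; each statement's English description precedes it below -/
import Mathlib

section
/- Let f(x) = log(1 + x²) on ℝ and let f⁽⁴⁾ denote its fourth derivative, so that f⁽⁴⁾(x) f(x)³ = −12 (1 − 6x² + x⁴)(log(1+x²))³ / (1+x²)⁴. Then ∫_ℝ f⁽⁴⁾(x) f(x)³ dx = −(41/6)π + π³ + π · (log 4) · (log 64 − 7); in particular this integral is strictly negative. -/
open MeasureTheory Filter Topology

lemma aux_L_nonneg (x : ℝ) : 0 ≤ Real.log (1 + x ^ 2) := Real.log_nonneg (by nlinarith [sq_nonneg x])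

lemma aux_bound (k : ℕ) : ∃ C : ℝ, 0 ≤ C ∧ ∀ x : ℝ, Real.log (1 + x ^ 2) ^ k ≤ C * (1 + x ^ 2) ^ (1/4 : ℝ) := by
  have hε : (0:ℝ) < 1 / (4 * (k + 1)) := by positivity
  refine ⟨(1 / (1 / (4 * (k + 1)) : ℝ)) ^ k, by positivity, fun x => ?_⟩
  have hu : (1:ℝ) ≤ 1 + x ^ 2 := by nlinarith [sq_nonneg x]
  have h1 := Real.log_le_rpow_div (x := 1 + x ^ 2) (by positivity) hε
  calc Real.log (1 + x ^ 2) ^ k ≤ ((1 + x ^ 2) ^ (1 / (4 * (k + 1)) : ℝ) / (1 / (4 * (k + 1)))) ^ k := by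
        gcongr
        exact aux_L_nonneg x
    _ = (1 / (1 / (4 * (k + 1)) : ℝ)) ^ k * (1 + x ^ 2) ^ ((1 / (4 * (k + 1)) : ℝ) * k) := by
        rw [Real.rpow_mul (by positivity), Real.rpow_natCast, ← mul_pow]
        congr 1
        ring
    _ ≤ _ := by
        gcongr
        rw [div_mul_eq_mul_div, div_le_div_iff₀ (by positivity) (by norm_num)]
        linarith

lemma aux_cont (k : ℕ) : Continuous fun x : ℝ => Real.log (1 + x ^ 2) ^ k := by
  refine Continuous.pow (Continuous.log (by fun_prop) fun x => by positivity) k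

lemma aux_cont_u : Continuous fun x : ℝ => (1 + x ^ 2)⁻¹ := by
  refine Continuous.inv₀ (by fun_prop) fun x => by positivity

lemma aux_int (k : ℕ) : Integrable fun x : ℝ => Real.log (1 + x ^ 2) ^ k * (1 + x ^ 2)⁻¹ := by
  obtain ⟨C, hC, h⟩ := aux_bound k
  have h0 : Integrable (fun x : ℝ => C * (1 + x ^ 2) ^ (-(3/2 : ℝ) / 2)) := by
    have := (integrable_rpow_neg_one_add_norm_sq (E := ℝ) (μ := volume) (r := 3/2) (by norm_num)).const_mul C
    simpa using this
  refine h0.mono' ((aux_cont k).mul aux_cont_u).aestronglyMeasurable (ae_of_all _ fun x => ?_)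
  have hu : (0:ℝ) < 1 + x ^ 2 := by positivity
  rw [Real.norm_of_nonneg (mul_nonneg (pow_nonneg (aux_L_nonneg x) k) (by positivity))]
  calc _ ≤ C * (1 + x ^ 2) ^ (1/4 : ℝ) * (1 + x ^ 2)⁻¹ := by gcongr; exact h x
    _ = _ := by
      rw [← Real.rpow_neg_one, mul_assoc, ← Real.rpow_add hu]
      norm_num

lemma aux_tend (k m : ℕ) (hm : 1 ≤ m) {l : Filter ℝ} (hl : Tendsto (fun x : ℝ => 1 + x ^ 2) l atTop) :
    Tendsto (fun x : ℝ => Real.log (1 + x ^ 2) ^ k * (x / (1 + x ^ 2) ^ m)) l (𝓝 0) := by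
  obtain ⟨C, hC, h⟩ := aux_bound k
  have h0 : Tendsto (fun x : ℝ => C * (1 + x ^ 2) ^ (-(1/4 : ℝ))) l (𝓝 0) := by
    have := ((tendsto_rpow_neg_atTop (y := 1/4) (by norm_num)).comp hl).const_mul C
    simpa using this
  refine squeeze_zero_norm (fun x => ?_) h0
  have hu : (0:ℝ) < 1 + x ^ 2 := by positivity
  have hu1 : (1:ℝ) ≤ 1 + x ^ 2 := by nlinarith [sq_nonneg x]
  rw [norm_mul, norm_div, Real.norm_of_nonneg (pow_nonneg (aux_L_nonneg x) k),
    Real.norm_of_nonneg (by positivity : (0:ℝ) ≤ (1 + x ^ 2) ^ m)]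
  have hx : ‖x‖ ≤ (1 + x ^ 2) ^ (1/2 : ℝ) := by
    rw [← Real.sqrt_eq_rpow, Real.norm_eq_abs]
    exact Real.abs_le_sqrt (by linarith)
  calc _ ≤ C * (1 + x ^ 2) ^ (1/4 : ℝ) * ((1 + x ^ 2) ^ (1/2 : ℝ) / (1 + x ^ 2) ^ 1) := by
        gcongr
        exact h x
    _ = _ := by
      rw [pow_one, div_eq_mul_inv _ (1 + x ^ 2), ← Real.rpow_neg_one (1 + x ^ 2), mul_assoc, ← Real.rpow_add hu, ← Real.rpow_add hu]
      norm_num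

lemma aux_dS (m : ℕ) (x : ℝ) : HasDerivAt (fun x : ℝ => x / (1 + x ^ 2) ^ m)
    ((1 - 2 * (m : ℝ)) * ((1 + x ^ 2)⁻¹) ^ m + 2 * (m : ℝ) * ((1 + x ^ 2)⁻¹) ^ (m + 1)) x := by
  have hu : (1 + x ^ 2) ≠ 0 := by positivity
  have h1 : HasDerivAt (fun x : ℝ => 1 + x ^ 2) (2 * x) x := by
    simpa using (hasDerivAt_pow 2 x).const_add 1
  have h2 := (hasDerivAt_id x).div (h1.pow m) (pow_ne_zero m hu)
  refine h2.congr_deriv ?_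
  rcases m with _ | m
  · simp
  · simp only [id, Nat.add_sub_cancel, Pi.pow_apply]
    push_cast
    simp only [inv_pow]
    field_simp
    ring

lemma aux_dL (x : ℝ) : HasDerivAt (fun x : ℝ => Real.log (1 + x ^ 2)) (2 * (x / (1 + x ^ 2) ^ 1)) x := by
  have hu : (1 + x ^ 2) ≠ 0 := by positivity
  have h1 : HasDerivAt (fun x : ℝ => 1 + x ^ 2) (2 * x) x := by
    simpa using (hasDerivAt_pow 2 x).const_add 1
  refine (h1.log hu).congr_deriv ?_
  ring

lemma aux_iter (x : ℝ) : iteratedDeriv 4 (fun y : ℝ => Real.log (1 + y ^ 2)) x =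
    -12 * ((1 + x ^ 2)⁻¹) ^ 2 + 96 * ((1 + x ^ 2)⁻¹) ^ 3 - 96 * ((1 + x ^ 2)⁻¹) ^ 4 := by
  have e1 : deriv (fun y : ℝ => Real.log (1 + y ^ 2)) = fun x => 2 * (x / (1 + x ^ 2) ^ 1) :=
    funext fun x => (aux_dL x).deriv
  have e2 : deriv (fun x : ℝ => 2 * (x / (1 + x ^ 2) ^ 1)) =
      fun x => -2 * ((1 + x ^ 2)⁻¹) + 4 * ((1 + x ^ 2)⁻¹) ^ 2 := funext fun x => by
    rw [((aux_dS 1 x).const_mul 2).deriv]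
    push_cast
    ring
  have e3 : deriv (fun x : ℝ => -2 * ((1 + x ^ 2)⁻¹) + 4 * ((1 + x ^ 2)⁻¹) ^ 2) =
      fun x => 4 * (x / (1 + x ^ 2) ^ 2) - 16 * (x / (1 + x ^ 2) ^ 3) := funext fun x => by
    have hu : (1 + x ^ 2) ≠ 0 := by positivity
    have h1 : HasDerivAt (fun x : ℝ => 1 + x ^ 2) (2 * x) x := by
      simpa using (hasDerivAt_pow 2 x).const_add 1
    have h2 := h1.fun_inv hu
    have h3 := (h2.const_mul (-2)).fun_add ((h2.fun_pow 2).const_mul 4)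
    rw [h3.deriv]
    norm_num
    field_simp
    ring
  rw [iteratedDeriv_succ', iteratedDeriv_succ', iteratedDeriv_succ', iteratedDeriv_one, e1, e2, e3,
    (((aux_dS 2 x).const_mul 4).fun_sub ((aux_dS 3 x).const_mul 16)).deriv]
  push_cast
  ring

noncomputable def auxG (x : ℝ) : ℝ :=
  (4 * (Real.log (1 + x ^ 2) ^ 3 * (x / (1 + x ^ 2) ^ 2)) - 16 * (Real.log (1 + x ^ 2) ^ 3 * (x / (1 + x ^ 2) ^ 3)))
  + (3 * (Real.log (1 + x ^ 2) ^ 2 * (x / (1 + x ^ 2) ^ 1)) + 10 * (Real.log (1 + x ^ 2) ^ 2 * (x / (1 + x ^ 2) ^ 2))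
      - 16 * (Real.log (1 + x ^ 2) ^ 2 * (x / (1 + x ^ 2) ^ 3)))
  + (5 * (Real.log (1 + x ^ 2) ^ 1 * (x / (1 + x ^ 2) ^ 1)) + 38 / 3 * (Real.log (1 + x ^ 2) ^ 1 * (x / (1 + x ^ 2) ^ 2))
      - 32 / 3 * (Real.log (1 + x ^ 2) ^ 1 * (x / (1 + x ^ 2) ^ 3)))
  + (19 / 6 * (Real.log (1 + x ^ 2) ^ 0 * (x / (1 + x ^ 2) ^ 1)) + 65 / 9 * (Real.log (1 + x ^ 2) ^ 0 * (x / (1 + x ^ 2) ^ 2))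
      - 32 / 9 * (Real.log (1 + x ^ 2) ^ 0 * (x / (1 + x ^ 2) ^ 3)))

lemma auxG_tend {l : Filter ℝ} (hl : Tendsto (fun x : ℝ => 1 + x ^ 2) l atTop) :
    Tendsto auxG l (𝓝 0) := by
  have T := fun k m (c : ℝ) (hm : 1 ≤ m) => (aux_tend k m hm hl).const_mul c
  have := ((((T 3 2 4 (by norm_num)).sub (T 3 3 16 (by norm_num))).add
    (((T 2 1 3 (by norm_num)).add (T 2 2 10 (by norm_num))).sub (T 2 3 16 (by norm_num)))).add
    (((T 1 1 5 (by norm_num)).add (T 1 2 (38/3) (by norm_num))).sub (T 1 3 (32/3) (by norm_num)))).add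
    (((T 0 1 (19/6) (by norm_num)).add (T 0 2 (65/9) (by norm_num))).sub (T 0 3 (32/9) (by norm_num)))
  simp only [mul_zero, sub_zero, add_zero] at this
  exact this

lemma auxG_deriv (x : ℝ) : HasDerivAt auxG
    ((-12 * ((1 + x ^ 2)⁻¹) ^ 2 + 96 * ((1 + x ^ 2)⁻¹) ^ 3 - 96 * ((1 + x ^ 2)⁻¹) ^ 4) * Real.log (1 + x ^ 2) ^ 3
      - (3 * (Real.log (1 + x ^ 2) ^ 2 * (1 + x ^ 2)⁻¹) - 7 * (Real.log (1 + x ^ 2) ^ 1 * (1 + x ^ 2)⁻¹)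
        - 41 / 6 * (Real.log (1 + x ^ 2) ^ 0 * (1 + x ^ 2)⁻¹))) x := by
  have D := fun k m (c : ℝ) => (((aux_dL x).fun_pow k).fun_mul (aux_dS m x)).const_mul c
  have := ((((D 3 2 4).fun_sub (D 3 3 16)).fun_add
    (((D 2 1 3).fun_add (D 2 2 10)).fun_sub (D 2 3 16))).fun_add
    (((D 1 1 5).fun_add (D 1 2 (38/3))).fun_sub (D 1 3 (32/3)))).fun_add
    (((D 0 1 (19/6)).fun_add (D 0 2 (65/9))).fun_sub (D 0 3 (32/9)))
  refine this.congr_deriv ?_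
  generalize Real.log (1 + x ^ 2) = L
  have hu : (1 + x ^ 2) ≠ 0 := by positivity
  norm_num
  field_simp
  ring

lemma aux_red : ∫ x : ℝ, iteratedDeriv 4 (fun y : ℝ => Real.log (1 + y ^ 2)) x
        * (Real.log (1 + x ^ 2)) ^ 3 = 3 * (∫ x : ℝ, Real.log (1 + x ^ 2) ^ 2 * (1 + x ^ 2)⁻¹)
        - 7 * (∫ x : ℝ, Real.log (1 + x ^ 2) ^ 1 * (1 + x ^ 2)⁻¹)
        - 41 / 6 * (∫ x : ℝ, Real.log (1 + x ^ 2) ^ 0 * (1 + x ^ 2)⁻¹) := by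
  simp_rw [aux_iter]
  have i1 : Integrable fun x : ℝ => (-12 * ((1 + x ^ 2)⁻¹) ^ 2 + 96 * ((1 + x ^ 2)⁻¹) ^ 3 - 96 * ((1 + x ^ 2)⁻¹) ^ 4) * Real.log (1 + x ^ 2) ^ 3 := by
    refine ((aux_int 3).const_mul 204).mono' ?_ (ae_of_all _ fun x => ?_)
    · have h1 := aux_cont_u
      have h2 := aux_cont 3
      exact Continuous.aestronglyMeasurable (by fun_prop)
    · have hL := pow_nonneg (aux_L_nonneg x) 3
      have h0 : 0 ≤ (1 + x ^ 2)⁻¹ := by positivity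
      have h1 : (1 + x ^ 2)⁻¹ ≤ 1 := inv_le_one_of_one_le₀ (by nlinarith [sq_nonneg x])
      rw [norm_mul, Real.norm_of_nonneg hL, mul_comm, mul_left_comm]
      gcongr
      generalize (1 + x ^ 2)⁻¹ = v at *
      have a2 : v ^ 2 ≤ v := pow_le_of_le_one h0 h1 (by norm_num)
      have a3 : v ^ 3 ≤ v := pow_le_of_le_one h0 h1 (by norm_num)
      have a4 : v ^ 4 ≤ v := pow_le_of_le_one h0 h1 (by norm_num)
      have b2 : 0 ≤ v ^ 2 := by positivity
      have b3 : 0 ≤ v ^ 3 := by positivity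
      have b4 : 0 ≤ v ^ 4 := by positivity
      rw [Real.norm_eq_abs, abs_le]
      constructor <;> linarith
  have j2 := (aux_int 2).const_mul 3
  have j1 := (aux_int 1).const_mul 7
  have j0 := (aux_int 0).const_mul (41/6)
  have htop : Tendsto (fun x : ℝ => 1 + x ^ 2) atTop atTop :=
    tendsto_atTop_add_const_left _ _ (tendsto_pow_atTop (by norm_num))
  have hbot : Tendsto (fun x : ℝ => 1 + x ^ 2) atBot atTop :=
    tendsto_atTop_add_const_left _ _ (by simpa using (tendsto_pow_atTop (α := ℝ) two_ne_zero).comp tendsto_abs_atBot_atTop |>.congr fun x => sq_abs x)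
  have := integral_of_hasDerivAt_of_tendsto auxG_deriv (i1.sub ((j2.sub j1).sub j0))
    (auxG_tend hbot) (auxG_tend htop)
  have e2 := integral_sub i1 ((j2.sub j1).sub j0)
  have e1 := integral_sub (j2.sub j1) j0
  have e0 := integral_sub j2 j1
  simp only [Pi.sub_apply, integral_const_mul] at e0 e1 e2
  rw [e2, e1, e0] at this
  linarith

noncomputable def auxw (x : ℝ) : ℂ := Complex.exp (2 * Real.arctan x * Complex.I)

lemma auxw_norm (x : ℝ) : ‖auxw x‖ = 1 := by
  have := Complex.norm_exp_ofReal_mul_I (2 * Real.arctan x)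
  rw [auxw]
  exact_mod_cast this

lemma auxw_cont : Continuous auxw := by
  unfold auxw
  fun_prop

lemma aux_log_two_cos (x : ℝ) :
    Real.log (2 * Real.cos (Real.arctan x)) = Real.log 2 - Real.log (1 + x ^ 2) / 2 := by
  have hu : (0:ℝ) < 1 + x ^ 2 := by positivity
  rw [Real.cos_arctan, mul_one_div, Real.log_div (by norm_num) (by positivity), Real.log_sqrt hu.le]

lemma auxw_eq (x : ℝ) : 1 + auxw x = Complex.exp ((Real.log (2 * Real.cos (Real.arctan x)) : ℝ)
    + Real.arctan x * Complex.I) := by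
  have hc : 0 < 2 * Real.cos (Real.arctan x) := by linarith [Real.cos_arctan_pos x]
  rw [Complex.exp_add, ← Complex.ofReal_exp, Real.exp_log hc, auxw]
  push_cast
  rw [Complex.two_cos, add_mul, ← Complex.exp_add, ← Complex.exp_add]
  rw [add_comm]
  congr 1
  · congr 1; ring
  · rw [← Complex.exp_zero]; congr 1; ring

lemma auxw_log (x : ℝ) : Complex.log (1 + auxw x) =
    ((Real.log 2 - Real.log (1 + x ^ 2) / 2 : ℝ) : ℂ) + Real.arctan x * Complex.I := by
  rw [auxw_eq, Complex.log_exp, aux_log_two_cos]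
  · simp only [Complex.add_im, Complex.ofReal_im, Complex.im_ofReal_mul, Complex.I_im, zero_add, mul_one]
    linarith [Real.neg_pi_div_two_lt_arctan x, Real.pi_pos]
  · simp only [Complex.add_im, Complex.ofReal_im, Complex.im_ofReal_mul, Complex.I_im, zero_add, mul_one]
    linarith [Real.arctan_lt_pi_div_two x, Real.pi_pos]

lemma auxw_slit (x r : ℝ) (h0 : 0 ≤ r) (h1 : r < 1) : 1 + r * auxw x ∈ Complex.slitPlane := by
  apply Complex.mem_slitPlane_of_norm_lt_one
  rw [norm_mul, auxw_norm, mul_one, Complex.norm_real, Real.norm_of_nonneg h0]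
  exact h1

lemma auxw_slit1 (x : ℝ) : 1 + auxw x ∈ Complex.slitPlane := by
  left
  have h : (auxw x).re = Real.cos (2 * Real.arctan x) := by
    have := Complex.exp_ofReal_mul_I_re (2 * Real.arctan x)
    rw [auxw]
    exact_mod_cast this
  have := Real.cos_arctan_pos x
  rw [Complex.add_re, h, Real.cos_two_mul]
  simp
  positivity

lemma auxw_lower (x r : ℝ) (h0 : 0 ≤ r) (h1 : r < 1) :
    Real.cos (Real.arctan x) ≤ ‖1 + r * auxw x‖ := by
  have hc := Real.cos_arctan_pos x
  have e1 : ‖1 + auxw x‖ = 2 * Real.cos (Real.arctan x) := by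
    rw [auxw_eq, Complex.norm_exp]
    simp only [Complex.add_re, Complex.ofReal_re, Complex.re_ofReal_mul, Complex.I_re, mul_zero, add_zero]
    rw [Real.exp_log (by linarith)]
  have e2 : ‖1 + auxw x‖ ≤ ‖1 + r * auxw x‖ + (1 - r) := by
    have : 1 + auxw x = (1 + r * auxw x) + ((1 - r : ℝ) : ℂ) * auxw x := by push_cast; ring
    rw [this]
    refine (norm_add_le _ _).trans ?_
    rw [norm_mul, auxw_norm, mul_one, Complex.norm_real, Real.norm_of_nonneg (by linarith)]
  have e3 : 1 - r ≤ ‖1 + r * auxw x‖ := by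
    have := norm_sub_le_norm_add (1 : ℂ) (r * auxw x)
    rw [norm_mul, auxw_norm, mul_one, Complex.norm_real, Real.norm_of_nonneg h0, norm_one] at this
    exact this
  linarith

lemma auxw_logbound (x r : ℝ) (h0 : 0 ≤ r) (h1 : r < 1) :
    ‖Complex.log (1 + r * auxw x)‖ ≤ Real.log 2 + Real.pi + Real.log (1 + x ^ 2) := by
  have hl := auxw_lower x r h0 h1
  have hc := Real.cos_arctan_pos x
  have hu : ‖1 + r * auxw x‖ ≤ 2 := by
    refine (norm_add_le _ _).trans ?_
    rw [norm_mul, auxw_norm, mul_one, Complex.norm_real, Real.norm_of_nonneg h0, norm_one]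
    linarith
  have a1 : Real.log ‖1 + r * auxw x‖ ≤ Real.log 2 := Real.log_le_log (by linarith) hu
  have a2 := Real.log_le_log hc hl
  have a3 := aux_log_two_cos x
  rw [Real.log_mul (by norm_num) hc.ne'] at a3
  have hL := aux_L_nonneg x
  have h2 : 0 ≤ Real.log 2 := Real.log_nonneg (by norm_num)
  refine (Complex.norm_le_abs_re_add_abs_im _).trans ?_
  have b1 : |(Complex.log (1 + r * auxw x)).re| ≤ Real.log 2 + Real.log (1 + x ^ 2) := by
    rw [Complex.log_re, abs_le]
    constructor <;> linarith
  have b2 : |(Complex.log (1 + r * auxw x)).im| ≤ Real.pi := by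
    rw [Complex.log_im]
    exact Complex.abs_arg_le_pi _
  linarith

lemma aux_change (g : ℝ → ℂ) : ∫ θ in (0:ℝ)..2 * Real.pi, g θ =
    ∫ x : ℝ, (2 * (1 + x ^ 2)⁻¹ : ℝ) • g (2 * Real.arctan x + Real.pi) := by
  have hpi := Real.pi_pos
  have him : (fun x => 2 * Real.arctan x + Real.pi) '' Set.univ = Set.Ioo 0 (2 * Real.pi) := by
    ext y
    simp only [Set.mem_image, Set.mem_univ, true_and, Set.mem_Ioo]
    constructor
    · rintro ⟨x, rfl⟩
      have := Real.neg_pi_div_two_lt_arctan x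
      have := Real.arctan_lt_pi_div_two x
      constructor <;> linarith
    · rintro ⟨h1, h2⟩
      refine ⟨Real.tan ((y - Real.pi) / 2), ?_⟩
      rw [Real.arctan_tan (by linarith) (by linarith)]
      ring
  rw [intervalIntegral.integral_of_le (by positivity), integral_Ioc_eq_integral_Ioo, ← him,
    integral_image_eq_integral_abs_deriv_smul (f' := fun x => 2 * (1 + x ^ 2)⁻¹) MeasurableSet.univ, setIntegral_univ]
  · refine integral_congr_ae (ae_of_all _ fun x => ?_)
    simp only
    rw [abs_of_nonneg (by positivity)]
  · intro x _
    exact (((Real.hasDerivAt_arctan' x).const_mul 2).add_const Real.pi).hasDerivWithinAt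
  · intro a _ b _ h
    simp only [add_left_inj, mul_eq_mul_left_iff] at h
    rcases h with h | h
    · exact Real.arctan_injective h
    · norm_num at h

lemma aux_mean (k : ℕ) (hk : k ≠ 0) (r : ℝ) (h0 : 0 ≤ r) (h1 : r < 1) :
    ∫ x : ℝ, (2 * (1 + x ^ 2)⁻¹ : ℝ) • Complex.log (1 + r * auxw x) ^ k = 0 := by
  have h := DiffContOnCl.circleAverage (f := fun z : ℂ => Complex.log (1 + z) ^ k) (c := 0) (R := r) (by
    apply DifferentiableOn.diffContOnCl
    intro z hz
    have hz' : ‖z‖ < 1 := by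
      have := Metric.closure_ball_subset_closedBall hz
      rw [mem_closedBall_zero_iff, abs_of_nonneg h0] at this
      linarith
    have := Complex.mem_slitPlane_of_norm_lt_one hz'
    apply DifferentiableAt.differentiableWithinAt
    apply DifferentiableAt.pow
    exact DifferentiableAt.clog (by fun_prop) this)
  rw [Real.circleAverage_eq_integral_add (-Real.pi), aux_change] at h
  simp only [add_zero, Complex.log_one, zero_pow hk, smul_eq_zero] at h
  have h := h.resolve_left (by positivity)
  rw [← h]
  refine integral_congr_ae (ae_of_all _ fun x => ?_)
  simp only [circleMap, auxw]
  push_cast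
  simp

lemma aux_limit_bound (k : ℕ) (hk : k ≤ 2) :
    Integrable fun x : ℝ => 2 * (1 + x ^ 2)⁻¹ * (Real.log 2 + Real.pi + Real.log (1 + x ^ 2)) ^ k := by
  interval_cases k
  · simpa using (aux_int 0).const_mul 2
  · refine (((aux_int 0).const_mul (2 * (Real.log 2 + Real.pi))).add ((aux_int 1).const_mul 2)).congr
      (ae_of_all _ fun x => ?_)
    simp only [Pi.add_apply]
    ring
  · refine ((((aux_int 0).const_mul (2 * (Real.log 2 + Real.pi) ^ 2)).add
      ((aux_int 1).const_mul (4 * (Real.log 2 + Real.pi)))).add ((aux_int 2).const_mul 2)).congr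
      (ae_of_all _ fun x => ?_)
    simp only [Pi.add_apply]
    ring

lemma aux_limit (k : ℕ) (hk : k ≠ 0) (hk2 : k ≤ 2) :
    ∫ x : ℝ, (2 * (1 + x ^ 2)⁻¹ : ℝ) • Complex.log (1 + auxw x) ^ k = 0 := by
  have hev : ∀ᶠ r : ℝ in 𝓝[<] 1, 0 ≤ r ∧ r < 1 := by
    have := Ioo_mem_nhdsLT (zero_lt_one (α := ℝ))
    filter_upwards [this] with r hr
    exact ⟨hr.1.le, hr.2⟩
  have T : Tendsto (fun r : ℝ => ∫ x : ℝ, (2 * (1 + x ^ 2)⁻¹ : ℝ) • Complex.log (1 + r * auxw x) ^ k) (𝓝[<] 1)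
      (𝓝 (∫ x : ℝ, (2 * (1 + x ^ 2)⁻¹ : ℝ) • Complex.log (1 + auxw x) ^ k)) := by
    refine tendsto_integral_filter_of_dominated_convergence _ ?_ ?_ (aux_limit_bound k hk2) ?_
    · filter_upwards [hev] with r hr
      refine Continuous.aestronglyMeasurable ?_
      refine (continuous_const.mul aux_cont_u).smul (Continuous.pow (Continuous.clog ?_ ?_) k)
      · have := auxw_cont
        fun_prop
      · exact fun x => auxw_slit x r hr.1 hr.2
    · filter_upwards [hev] with r hr
      refine ae_of_all _ fun x => ?_
      rw [norm_smul, Real.norm_of_nonneg (by positivity), norm_pow]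
      gcongr
      exact auxw_logbound x r hr.1 hr.2
    · refine ae_of_all _ fun x => ?_
      refine Tendsto.const_smul (Tendsto.pow (Tendsto.clog ?_ (auxw_slit1 x)) k) _
      have : Continuous fun r : ℝ => 1 + (r : ℂ) * auxw x := by fun_prop
      have := this.tendsto 1
      simp only [Complex.ofReal_one, one_mul] at this
      exact this.mono_left nhdsWithin_le_nhds
  refine tendsto_nhds_unique T (tendsto_const_nhds.congr' ?_)
  filter_upwards [hev] with r hr
  exact (aux_mean k hk r hr.1 hr.2).symm

lemma aux_limit_int (k : ℕ) (hk2 : k ≤ 2) :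
    Integrable fun x : ℝ => (2 * (1 + x ^ 2)⁻¹ : ℝ) • Complex.log (1 + auxw x) ^ k := by
  refine (aux_limit_bound k hk2).mono' ?_ (ae_of_all _ fun x => ?_)
  · refine Continuous.aestronglyMeasurable ?_
    refine (continuous_const.mul aux_cont_u).smul (Continuous.pow (Continuous.clog ?_ ?_) k)
    · have := auxw_cont
      fun_prop
    · exact fun x => auxw_slit1 x
  · rw [norm_smul, Real.norm_of_nonneg (by positivity), norm_pow]
    gcongr
    rw [auxw_log]
    refine (norm_add_le _ _).trans ?_
    have hL := aux_L_nonneg x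
    have h2 : 0 ≤ Real.log 2 := Real.log_nonneg (by norm_num)
    have b1 : |Real.log 2 - Real.log (1 + x ^ 2) / 2| ≤ Real.log 2 + Real.log (1 + x ^ 2) := by
      rw [abs_le]; constructor <;> linarith
    have b2 : |Real.arctan x| ≤ Real.pi := by
      rw [abs_le]
      constructor <;> linarith [Real.neg_pi_div_two_lt_arctan x, Real.arctan_lt_pi_div_two x, Real.pi_pos]
    rw [norm_mul, Complex.norm_real, Complex.norm_real, Complex.norm_I, Real.norm_eq_abs, Real.norm_eq_abs]
    linarith

lemma aux_re (k : ℕ) (hk : k ≠ 0) (hk2 : k ≤ 2) :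
    ∫ x : ℝ, (2 * (1 + x ^ 2)⁻¹ : ℝ) * (Complex.log (1 + auxw x) ^ k).re = 0 := by
  have := Complex.reCLM.integral_comp_comm (aux_limit_int k hk2)
  rw [aux_limit k hk hk2] at this
  simp only [Complex.reCLM_apply, Complex.smul_re, smul_eq_mul, Complex.zero_re] at this
  exact this

lemma aux_I0 : ∫ x : ℝ, Real.log (1 + x ^ 2) ^ 0 * (1 + x ^ 2)⁻¹ = Real.pi := by
  simp

lemma aux_I1 : ∫ x : ℝ, Real.log (1 + x ^ 2) ^ 1 * (1 + x ^ 2)⁻¹ = 2 * Real.pi * Real.log 2 := by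
  have h := aux_re 1 (by norm_num) (by norm_num)
  have e := integral_sub ((aux_int 0).const_mul (2 * Real.log 2)) (aux_int 1)
  rw [integral_const_mul, aux_I0] at e
  have : ∫ x : ℝ, (2 * (1 + x ^ 2)⁻¹ : ℝ) * (Complex.log (1 + auxw x) ^ 1).re =
      ∫ x : ℝ, (2 * Real.log 2 * (Real.log (1 + x ^ 2) ^ 0 * (1 + x ^ 2)⁻¹) - Real.log (1 + x ^ 2) ^ 1 * (1 + x ^ 2)⁻¹) := by
    refine integral_congr_ae (ae_of_all _ fun x => ?_)
    simp only [auxw_log, pow_one, Complex.add_re, Complex.ofReal_re, Complex.re_ofReal_mul, Complex.I_re]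
    ring
  linarith

lemma aux_atan_int : Integrable fun x : ℝ => Real.arctan x ^ 2 * (1 + x ^ 2)⁻¹ := by
  refine ((aux_int 0).const_mul (Real.pi ^ 2)).mono' ?_ (ae_of_all _ fun x => ?_)
  · exact ((Real.continuous_arctan.pow 2).mul aux_cont_u).aestronglyMeasurable
  · rw [Real.norm_of_nonneg (by positivity), pow_zero, one_mul]
    refine mul_le_mul_of_nonneg_right ?_ (by positivity)
    apply sq_le_sq'
    all_goals linarith [Real.neg_pi_div_two_lt_arctan x, Real.arctan_lt_pi_div_two x, Real.pi_pos]

lemma aux_atan : ∫ x : ℝ, Real.arctan x ^ 2 * (1 + x ^ 2)⁻¹ = Real.pi ^ 3 / 12 := by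
  have hd : ∀ x : ℝ, HasDerivAt (fun x => Real.arctan x ^ 3 / 3) (Real.arctan x ^ 2 * (1 + x ^ 2)⁻¹) x := fun x => by
    refine (((Real.hasDerivAt_arctan' x).fun_pow 3).div_const 3).congr_deriv ?_
    norm_num
    ring
  have hb := ((tendsto_nhds_of_tendsto_nhdsWithin Real.tendsto_arctan_atBot).pow 3).div_const 3
  have ht := ((tendsto_nhds_of_tendsto_nhdsWithin Real.tendsto_arctan_atTop).pow 3).div_const 3
  rw [integral_of_hasDerivAt_of_tendsto hd aux_atan_int hb ht]
  ring

lemma aux_I2 : ∫ x : ℝ, Real.log (1 + x ^ 2) ^ 2 * (1 + x ^ 2)⁻¹ =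
    4 * Real.pi * Real.log 2 ^ 2 + Real.pi ^ 3 / 3 := by
  have h := aux_re 2 (by norm_num) (by norm_num)
  have i0 := (aux_int 0).const_mul (2 * Real.log 2 ^ 2)
  have i1 := (aux_int 1).const_mul (2 * Real.log 2)
  have i2 := (aux_int 2).const_mul (1 / 2)
  have i3 := aux_atan_int.const_mul 2
  have e1 := integral_sub i0 i1
  have e2 := integral_add (i0.sub i1) i2
  have e3 := integral_sub ((i0.sub i1).add i2) i3
  simp only [Pi.sub_apply, Pi.add_apply, integral_const_mul, aux_I0, aux_I1, aux_atan] at e1 e2 e3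
  have : ∫ x : ℝ, (2 * (1 + x ^ 2)⁻¹ : ℝ) * (Complex.log (1 + auxw x) ^ 2).re =
      ∫ x : ℝ, (2 * Real.log 2 ^ 2 * (Real.log (1 + x ^ 2) ^ 0 * (1 + x ^ 2)⁻¹)
        - 2 * Real.log 2 * (Real.log (1 + x ^ 2) ^ 1 * (1 + x ^ 2)⁻¹)
        + 1 / 2 * (Real.log (1 + x ^ 2) ^ 2 * (1 + x ^ 2)⁻¹)
        - 2 * (Real.arctan x ^ 2 * (1 + x ^ 2)⁻¹)) := by
    refine integral_congr_ae (ae_of_all _ fun x => ?_)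
    simp only [auxw_log, sq (_ : ℂ), Complex.mul_re, Complex.add_im, Complex.ofReal_im, Complex.im_ofReal_mul, Complex.I_im, Complex.add_re, Complex.ofReal_re, Complex.re_ofReal_mul, Complex.I_re]
    ring
  linarith

theorem stmt_1 :
    (∫ x : ℝ, iteratedDeriv 4 (fun y : ℝ => Real.log (1 + y ^ 2)) x
        * (Real.log (1 + x ^ 2)) ^ 3)
      = -(41 / 6) * Real.pi + Real.pi ^ 3 + Real.pi * Real.log 4 * (Real.log 64 - 7) ∧
    (∫ x : ℝ, iteratedDeriv 4 (fun y : ℝ => Real.log (1 + y ^ 2)) x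
        * (Real.log (1 + x ^ 2)) ^ 3) < 0 := by
  have h4 : Real.log 4 = 2 * Real.log 2 := by
    rw [show (4:ℝ) = 2 ^ 2 by norm_num, Real.log_pow]; norm_num
  have h64 : Real.log 64 = 6 * Real.log 2 := by
    rw [show (64:ℝ) = 2 ^ 6 by norm_num, Real.log_pow]; norm_num
  rw [aux_red, aux_I0, aux_I1, aux_I2, h4, h64]
  refine ⟨by ring, ?_⟩
  have l1 := Real.log_two_gt_d9
  have l2 := Real.log_two_lt_d9
  have p1 := Real.pi_lt_d2
  have p0 := Real.pi_pos
  have hp : Real.pi ^ 2 < 10 := by nlinarith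
  have hl : Real.log 2 ^ 2 < 0.49 := by nlinarith
  have : Real.pi * (Real.pi ^ 2 - 41 / 6 + 12 * Real.log 2 ^ 2 - 14 * Real.log 2) < 0 :=
    mul_neg_of_pos_of_neg p0 (by linarith)
  nlinarith
end

section
/- (Pólya) Let α > 0 and define F_α(x) = ∫₀^∞ e^{−t^α} cos(x t) dt for x > 0 (the integral converges absolutely since ∫₀^∞ e^{−t^α} dt < ∞). Then x^{α+1} F_α(x) → Γ(α+1) · sin(πα/2) as x → ∞. -/
open Complex MeasureTheory Set Filter Topology

/-- Integrand on the rotated ray. -/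
noncomputable def rotF (α β x φ s : ℝ) : ℂ :=
  cexp (I * (β + 1) * φ) * ((s ^ β : ℝ) : ℂ) *
    cexp (-((s ^ α : ℝ) : ℂ) * cexp (I * α * φ) + I * x * s * cexp (I * φ))

/-- Logarithmic derivative of the integrand in the angle. -/
noncomputable def rotL (α β x φ s : ℝ) : ℂ :=
  I * (β + 1) - I * α * ((s ^ α : ℝ) : ℂ) * cexp (I * α * φ) - x * s * cexp (I * φ)

lemma re_exponent (α x φ s : ℝ) :
    (-((s ^ α : ℝ) : ℂ) * cexp (I * α * φ) + I * x * s * cexp (I * φ)).re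
      = -(s ^ α) * Real.cos (α * φ) - s * (x * Real.sin φ) := by
  have h1 : I * (α : ℂ) * φ = ((α * φ : ℝ) : ℂ) * I := by push_cast; ring
  have h2 : I * (φ : ℂ) = (φ : ℂ) * I := by ring
  have h3 : I * (x : ℂ) * s = ((x * s : ℝ) : ℂ) * I := by push_cast; ring
  rw [h1, h2, h3, Complex.add_re, ← Complex.ofReal_neg, Complex.re_ofReal_mul, mul_assoc,
    Complex.re_ofReal_mul, Complex.exp_ofReal_mul_I_re, Complex.I_mul_re,
    Complex.exp_ofReal_mul_I_im]
  ring

lemma norm_rotF (α β x φ s : ℝ) (hs : 0 < s) :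
    ‖rotF α β x φ s‖ = s ^ β * Real.exp (-(s ^ α) * Real.cos (α * φ) - s * (x * Real.sin φ)) := by
  have h1 : I * ((β : ℂ) + 1) * φ = (((β + 1) * φ : ℝ) : ℂ) * I := by push_cast; ring
  rw [rotF, norm_mul, norm_mul, Complex.norm_exp (_ + _), re_exponent, h1,
    Complex.norm_exp_ofReal_mul_I, Complex.norm_real, Real.norm_of_nonneg (by positivity)]
  ring

lemma norm_rotF_le (α β x φ s c : ℝ) (hs : 0 < s) (hc : c ≤ Real.cos (α * φ))
    (hx : 0 ≤ x * Real.sin φ) :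
    ‖rotF α β x φ s‖ ≤ s ^ β * Real.exp (-c * s ^ α) := by
  rw [norm_rotF _ _ _ _ _ hs]
  have := Real.rpow_pos_of_pos hs α
  have := Real.rpow_pos_of_pos hs β
  gcongr
  nlinarith [mul_nonneg hs.le hx]

lemma norm_rotL_le (α β x φ s : ℝ) (hα : 0 < α) (hβ : 0 ≤ β) (hx0 : 0 ≤ x) (hs : 0 < s) :
    ‖rotL α β x φ s‖ ≤ (β + 1) + α * s ^ α + x * s := by
  have h1 : I * (α : ℂ) * φ = ((α * φ : ℝ) : ℂ) * I := by push_cast; ring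
  have h2 : I * (φ : ℂ) = (φ : ℂ) * I := by ring
  have e1 : ‖I * ((β : ℂ) + 1)‖ = β + 1 := by
    rw [norm_mul, Complex.norm_I, one_mul, ← Complex.ofReal_one, ← Complex.ofReal_add,
      Complex.norm_real, Real.norm_of_nonneg (by positivity)]
  have e2 : ‖I * α * ((s ^ α : ℝ) : ℂ) * cexp (I * α * φ)‖ = α * s ^ α := by
    rw [h1, norm_mul, Complex.norm_exp_ofReal_mul_I, norm_mul, norm_mul, Complex.norm_I,
      Complex.norm_real, Complex.norm_real, Real.norm_of_nonneg hα.le,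
      Real.norm_of_nonneg (by positivity)]
    ring
  have e3 : ‖(x : ℂ) * s * cexp (I * φ)‖ = x * s := by
    rw [h2, norm_mul, Complex.norm_exp_ofReal_mul_I, norm_mul,
      Complex.norm_real, Complex.norm_real, Real.norm_of_nonneg hx0,
      Real.norm_of_nonneg hs.le]
    ring
  calc _ ≤ _ := norm_sub_le _ _
    _ ≤ _ := add_le_add_left (norm_sub_le _ _) _
    _ = _ := by rw [e1, e2, e3]

lemma hasDerivAt_rotF (α β x φ s : ℝ) :
    HasDerivAt (fun φ : ℝ => rotF α β x φ s) (rotF α β x φ s * rotL α β x φ s) φ := by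
  have hid : HasDerivAt (fun φ : ℝ => (φ : ℂ)) 1 φ := Complex.ofRealCLM.hasDerivAt
  have h1 := ((hid.const_mul (I * ((β : ℂ) + 1))).cexp).mul_const ((s ^ β : ℝ) : ℂ)
  have h2 := ((hid.const_mul (I * (α : ℂ))).cexp).const_mul (-((s ^ α : ℝ) : ℂ))
  have h3 := ((hid.const_mul I).cexp).const_mul (I * x * s)
  have h := h1.mul (h2.add h3).cexp
  refine h.congr_deriv ?_
  simp only [rotF, rotL, Pi.add_apply]
  linear_combination (x * s * cexp (I * φ) * (cexp (I * (β + 1) * φ) * ((s ^ β : ℝ) : ℂ) *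
    cexp (-((s ^ α : ℝ) : ℂ) * cexp (I * α * φ) + I * x * s * cexp (I * φ)))) * Complex.I_sq

lemma hasDerivAt_rotG (α β x φ s : ℝ) (hs : 0 < s) :
    HasDerivAt (fun s : ℝ => I * s * rotF α β x φ s) (rotF α β x φ s * rotL α β x φ s) s := by
  have hid : HasDerivAt (fun s : ℝ => (s : ℂ)) 1 s := Complex.ofRealCLM.hasDerivAt
  have hβ : HasDerivAt (fun s : ℝ => ((s ^ β : ℝ) : ℂ)) ((β * s ^ (β - 1) : ℝ) : ℂ) s :=
    (Real.hasDerivAt_rpow_const (Or.inl hs.ne')).ofReal_comp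
  have hα : HasDerivAt (fun s : ℝ => ((s ^ α : ℝ) : ℂ)) ((α * s ^ (α - 1) : ℝ) : ℂ) s :=
    (Real.hasDerivAt_rpow_const (Or.inl hs.ne')).ofReal_comp
  have h1 := hβ.const_mul (cexp (I * (β + 1) * φ))
  have h2 := hα.neg.mul_const (cexp (I * α * φ))
  have h3 := (hid.const_mul (I * x)).mul_const (cexp (I * φ))
  have h := (hid.const_mul I).mul (h1.mul (h2.add h3).cexp)
  refine h.congr_deriv ?_
  have eβ : ((s ^ β : ℝ) : ℂ) = s * ((s ^ (β - 1) : ℝ) : ℂ) := by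
    rw [← Complex.ofReal_mul, Real.rpow_sub_one hs.ne']; congr 1; field_simp
  have eα : ((s ^ α : ℝ) : ℂ) = s * ((s ^ (α - 1) : ℝ) : ℂ) := by
    rw [← Complex.ofReal_mul, Real.rpow_sub_one hs.ne']; congr 1; field_simp
  simp only [rotF, rotL, Pi.add_apply, Pi.mul_apply, Pi.neg_apply]
  push_cast
  generalize cexp (-((s ^ α : ℝ) : ℂ) * cexp (I * α * φ) + I * x * s * cexp (I * φ)) = E
  rw [eβ, eα]
  linear_combination (x * s * cexp (I * φ) * (cexp (I * (β + 1) * φ) *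
    (s * ((s ^ (β - 1) : ℝ) : ℂ)) * E)) * Complex.I_sq

lemma continuousOn_rotF (α β x φ : ℝ) (hα : 0 < α) (hβ : 0 ≤ β) :
    Continuous (fun s : ℝ => rotF α β x φ s) := by
  have h1 : Continuous fun s : ℝ => s ^ α := Real.continuous_rpow_const hα.le
  have h2 : Continuous fun s : ℝ => s ^ β := Real.continuous_rpow_const hβ
  unfold rotF
  fun_prop

lemma continuous_rotL (α β x φ : ℝ) (hα : 0 < α) :
    Continuous (fun s : ℝ => rotL α β x φ s) := by
  have h1 : Continuous fun s : ℝ => s ^ α := Real.continuous_rpow_const hα.le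
  unfold rotL
  fun_prop

lemma integrable_bd (α β c : ℝ) (hα : 0 < α) (hβ : 0 ≤ β) (hc : 0 < c) :
    IntegrableOn (fun s : ℝ => s ^ β * Real.exp (-c * s ^ α)) (Ioi 0) :=
  integrableOn_rpow_mul_exp_neg_mul_rpow (by linarith) hα hc

lemma rot_const (α β x a b c : ℝ) (hα : 0 < α) (hβ : 0 ≤ β) (hx0 : 0 ≤ x) (hc : 0 < c)
    (hab : a < b) (h : ∀ φ ∈ Icc a b, c ≤ Real.cos (α * φ) ∧ 0 ≤ x * Real.sin φ) :
    ∫ s in Ioi (0:ℝ), rotF α β x a s = ∫ s in Ioi (0:ℝ), rotF α β x b s := by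
  have hcont : ContinuousOn (fun φ => ∫ s in Ioi (0:ℝ), rotF α β x φ s) (Icc a b) := by
    refine continuousOn_of_dominated (bound := fun s => s ^ β * Real.exp (-c * s ^ α)) ?_ ?_
      (integrable_bd α β c hα hβ hc) ?_
    · intro φ _
      exact (continuousOn_rotF α β x φ hα hβ).aestronglyMeasurable
    · intro φ hφ
      filter_upwards [ae_restrict_mem measurableSet_Ioi] with s hs
      exact norm_rotF_le _ _ _ _ _ _ hs (h φ hφ).1 (h φ hφ).2
    · refine Eventually.of_forall fun s φ _ => ?_
      exact (hasDerivAt_rotF α β x φ s).continuousAt.continuousWithinAt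
  have hderiv : ∀ φ ∈ Ioo a b,
      HasDerivAt (fun φ => ∫ s in Ioi (0:ℝ), rotF α β x φ s) 0 φ := by
    intro φ hφ
    have hbi : IntegrableOn (fun s : ℝ => s ^ β * Real.exp (-c * s ^ α) *
        ((β + 1) + α * s ^ α + x * s)) (Ioi 0) := by
      have i1 := (integrable_bd α β c hα hβ hc).const_mul (β + 1)
      have i2 := (integrable_bd α (β + α) c hα (by positivity) hc).const_mul α
      have i3 := (integrable_bd α (β + 1) c hα (by positivity) hc).const_mul x
      refine IntegrableOn.congr_fun ((i1.add i2).add i3) ?_ measurableSet_Ioi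
      intro s hs
      simp only [Pi.add_apply]
      rw [Real.rpow_add hs, Real.rpow_add hs, Real.rpow_one]
      ring
    have hint : IntegrableOn (fun s => rotF α β x φ s) (Ioi 0) := by
      refine (integrable_bd α β c hα hβ hc).mono'
        (continuousOn_rotF α β x φ hα hβ).aestronglyMeasurable ?_
      filter_upwards [ae_restrict_mem measurableSet_Ioi] with s hs
      have := h φ (Ioo_subset_Icc_self hφ)
      exact norm_rotF_le _ _ _ _ _ _ hs this.1 this.2
    have key := hasDerivAt_integral_of_dominated_loc_of_deriv_le
      (μ := volume.restrict (Ioi (0:ℝ))) (F := fun φ s => rotF α β x φ s)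
      (F' := fun φ s => rotF α β x φ s * rotL α β x φ s)
      (bound := fun s : ℝ => s ^ β * Real.exp (-c * s ^ α) * ((β + 1) + α * s ^ α + x * s))
      (Ioo_mem_nhds hφ.1 hφ.2)
      (Eventually.of_forall fun φ => (continuousOn_rotF α β x φ hα hβ).aestronglyMeasurable)
      hint
      ((continuousOn_rotF α β x φ hα hβ).mul
        (continuous_rotL α β x φ hα)).aestronglyMeasurable
      (by
        filter_upwards [ae_restrict_mem measurableSet_Ioi] with s hs
        intro ψ hψ
        have := h ψ (Ioo_subset_Icc_self hψ)
        rw [norm_mul]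
        have hs' : 0 < s := hs
        have := norm_rotF_le α β x ψ s c hs this.1 this.2
        have := norm_rotL_le α β x ψ s hα hβ hx0 hs
        gcongr)
      hbi
      (Eventually.of_forall fun s ψ _ => hasDerivAt_rotF α β x ψ s)
    refine key.2.congr_deriv ?_
    have hz := integral_Ioi_of_hasDerivAt_of_tendsto (a := 0) (m := 0)
      (f := fun s : ℝ => I * s * rotF α β x φ s)
      (f' := fun s => rotF α β x φ s * rotL α β x φ s)
      (by
        have := continuousOn_rotF α β x φ hα hβ
        exact Continuous.continuousWithinAt (by fun_prop))
      (fun s hs => hasDerivAt_rotG α β x φ s hs) key.1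
      (by
        have t1 := (tendsto_rpow_mul_exp_neg_mul_atTop_nhds_zero ((β + 1) / α) c hc).comp
          (tendsto_rpow_atTop hα)
        refine squeeze_zero_norm' ?_ t1
        filter_upwards [eventually_gt_atTop 0] with s hs
        have := h φ (Ioo_subset_Icc_self hφ)
        have := norm_rotF_le α β x φ s c hs this.1 this.2
        simp only [Function.comp]
        rw [← Real.rpow_mul hs.le, mul_div_cancel₀ _ hα.ne', Real.rpow_add hs, Real.rpow_one,
          norm_mul, norm_mul, Complex.norm_I, Complex.norm_real, Real.norm_of_nonneg hs.le]
        nlinarith)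
    simpa using hz
  have hconst : ∀ y ∈ Ioo a b, ∀ z ∈ Ioo a b, (∫ s in Ioi (0:ℝ), rotF α β x y s)
      = ∫ s in Ioi (0:ℝ), rotF α β x z s := by
    intro y hy z hz
    exact isOpen_Ioo.is_const_of_deriv_eq_zero isPreconnected_Ioo
      (fun φ hφ => (hderiv φ hφ).differentiableAt.differentiableWithinAt)
      (fun φ hφ => (hderiv φ hφ).deriv) hy hz
  have hm : (a + b) / 2 ∈ Ioo a b := ⟨by linarith, by linarith⟩
  have heq : EqOn (fun φ => ∫ s in Ioi (0:ℝ), rotF α β x φ s)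
      (fun _ => ∫ s in Ioi (0:ℝ), rotF α β x ((a + b) / 2) s) (Icc a b) := by
    have : EqOn (fun φ => ∫ s in Ioi (0:ℝ), rotF α β x φ s)
      (fun _ => ∫ s in Ioi (0:ℝ), rotF α β x ((a + b) / 2) s) (Ioo a b) :=
      fun y hy => hconst y hy _ hm
    exact this.of_subset_closure hcont continuousOn_const Ioo_subset_Icc_self
      (by rw [closure_Ioo hab.ne])
  exact (heq (left_mem_Icc.2 hab.le)).trans (heq (right_mem_Icc.2 hab.le)).symm

lemma gamma_rot (β θ : ℝ) (hβ : 0 ≤ β) (h0 : 0 < θ) (h1 : θ < Real.pi / 2) :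
    ∫ s in Ioi (0:ℝ), cexp (I * (β + 1) * θ) * ((s ^ β : ℝ) : ℂ) * cexp (I * s * cexp (I * θ))
      = cexp (I * (β + 1) * (Real.pi / 2)) * (Real.Gamma (β + 1) : ℝ) := by
  have hr := rot_const 1 β 0 (θ - Real.pi / 2) 0 (Real.sin θ) one_pos hβ le_rfl
    (Real.sin_pos_of_pos_of_lt_pi h0 (by linarith [Real.pi_pos])) (by linarith) (by
      intro φ hφ
      refine ⟨?_, by simp⟩
      rw [one_mul, ← Real.cos_pi_div_two_sub, ← Real.cos_neg φ]
      apply Real.cos_le_cos_of_nonneg_of_le_pi <;> linarith [hφ.1, hφ.2, Real.pi_pos])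
  have hg : ∫ s in Ioi (0:ℝ), rotF 1 β 0 0 s = (Real.Gamma (β + 1) : ℝ) := by
    rw [Real.Gamma_eq_integral (by linarith), ← integral_complex_ofReal]
    refine setIntegral_congr_fun measurableSet_Ioi fun s hs => ?_
    simp [rotF, mul_comm]
  rw [hg] at hr
  rw [← hr, ← integral_const_mul]
  refine setIntegral_congr_fun measurableSet_Ioi fun s hs => ?_
  have e1 : cexp (I * (β + 1) * (Real.pi / 2)) * cexp (I * (β + 1) * ((θ - Real.pi / 2 : ℝ) : ℂ))
      = cexp (I * (β + 1) * θ) := by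
    rw [← Complex.exp_add]; congr 1; push_cast; ring
  have e2 : cexp (I * ((θ - Real.pi / 2 : ℝ) : ℂ)) = -I * cexp (I * θ) := by
    rw [← Complex.exp_neg_pi_div_two_mul_I, ← Complex.exp_add]; congr 1; push_cast; ring
  simp only [rotF, Real.rpow_one, Complex.ofReal_one, mul_one, Complex.ofReal_zero, mul_zero,
    zero_mul, add_zero]
  rw [e2, ← e1]
  have e3 : -(s : ℂ) * (-I * cexp (I * θ)) = I * s * cexp (I * θ) := by ring
  rw [e3]
  ring

lemma norm_exp_sub_one_le_of_re (z : ℂ) (hz : z.re ≤ 0) : ‖cexp z - 1‖ ≤ ‖z‖ := by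
  have := Convex.norm_image_sub_le_of_norm_hasDerivWithin_le (𝕜 := ℂ) (f := cexp) (f' := cexp)
    (s := {w : ℂ | w.re ≤ 0}) (x := 0) (y := z) (C := 1)
    (fun w _ => (Complex.hasDerivAt_exp w).hasDerivWithinAt)
    (fun w hw => by rw [Complex.norm_exp]; exact Real.exp_le_one_iff.2 hw)
    (convex_halfSpace_re_le 0) (by simp) hz
  simpa using this

lemma integrable_rotF (α β x φ c : ℝ) (hα : 0 < α) (hβ : 0 ≤ β) (hc : 0 < c)
    (h : c ≤ Real.cos (α * φ)) (hx : 0 ≤ x * Real.sin φ) :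
    IntegrableOn (fun s => rotF α β x φ s) (Ioi 0) := by
  refine (integrable_bd α β c hα hβ hc).mono'
    (continuousOn_rotF α β x φ hα hβ).aestronglyMeasurable ?_
  filter_upwards [ae_restrict_mem measurableSet_Ioi] with s hs
  exact norm_rotF_le _ _ _ _ _ _ hs h hx

/-- The rescaled difference whose integral has the right limit. -/
noncomputable def rotD (α θ x u : ℝ) : ℂ :=
  cexp (I * θ) * (((x ^ α : ℝ) : ℂ) *
    (cexp (((x ^ (-α) : ℝ) : ℂ) * (-((u ^ α : ℝ) : ℂ) * cexp (I * α * θ))) - 1)) *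
    cexp (I * u * cexp (I * θ))

lemma main_eq (α θ x : ℝ) (hα : 0 < α) (h0 : 0 < θ) (h1 : θ < Real.pi / 2)
    (h2 : α * θ < Real.pi / 2) (hx : 0 < x) :
    x ^ (α + 1) * ∫ t in Ioi (0 : ℝ), Real.exp (-(t ^ α)) * Real.cos (x * t)
      = (∫ u in Ioi (0:ℝ), rotD α θ x u).re := by
  have hc : 0 < Real.cos (α * θ) :=
    Real.cos_pos_of_mem_Ioo ⟨by have := mul_pos hα h0; linarith [Real.pi_pos], h2⟩
  have hsin : 0 < Real.sin θ := Real.sin_pos_of_pos_of_lt_pi h0 (by linarith [Real.pi_pos])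
  have s1 : ∫ t in Ioi (0 : ℝ), Real.exp (-(t ^ α)) * Real.cos (x * t)
      = (∫ t in Ioi (0:ℝ), rotF α 0 x 0 t).re := by
    have hi := integrable_rotF α 0 x 0 1 hα le_rfl one_pos (by simp) (by simp)
    have := Complex.reCLM.integral_comp_comm hi
    simp only [Complex.reCLM_apply] at this
    rw [← this]
    refine setIntegral_congr_fun measurableSet_Ioi fun t ht => ?_
    have e : cexp (-((t ^ α : ℝ) : ℂ) + I * x * t)
        = ((Real.exp (-(t ^ α)) : ℝ) : ℂ) * cexp (((x * t : ℝ) : ℂ) * I) := by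
      rw [Complex.exp_add]; push_cast; congr 2; ring
    simp only [rotF, Complex.ofReal_zero, mul_zero, Complex.exp_zero, Real.rpow_zero,
      Complex.ofReal_one, mul_one, one_mul]
    rw [e, Complex.re_ofReal_mul, Complex.exp_ofReal_mul_I_re]
  have s2 := rot_const α 0 x 0 θ (Real.cos (α * θ)) hα le_rfl hx.le hc h0 (by
    intro φ hφ
    constructor
    · apply Real.cos_le_cos_of_nonneg_of_le_pi (mul_nonneg hα.le hφ.1) (by linarith [Real.pi_pos])
      exact mul_le_mul_of_nonneg_left hφ.2 hα.le
    · exact mul_nonneg hx.le (Real.sin_nonneg_of_nonneg_of_le_pi hφ.1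
        (by linarith [hφ.2, Real.pi_pos])))
  have hint := integrable_rotF α 0 x θ (Real.cos (α * θ)) hα le_rfl hc le_rfl
    (mul_nonneg hx.le hsin.le)
  have hint' : IntegrableOn (fun u => rotF α 0 x θ (x⁻¹ * u)) (Ioi 0) := by
    have := (integrableOn_Ioi_comp_mul_left_iff (fun s => rotF α 0 x θ s) 0
      (inv_pos.2 hx)).2 (by simpa using hint)
    exact this
  have s3 := integral_comp_mul_left_Ioi (fun s => rotF α 0 x θ s) 0 (inv_pos.2 hx)
  rw [mul_zero, inv_inv] at s3
  have hB := gamma_rot 0 θ le_rfl h0 h1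
  have hBv : cexp (I * (((0:ℝ) : ℂ) + 1) * (Real.pi / 2)) * (Real.Gamma (0 + 1) : ℝ) = I := by
    rw [zero_add, Real.Gamma_one, Complex.ofReal_zero, zero_add, mul_one, Complex.ofReal_one,
      mul_one, mul_comm, Complex.exp_pi_div_two_mul_I]
  rw [hBv] at hB
  have hBi := Integrable.of_integral_ne_zero (by rw [hB]; exact Complex.I_ne_zero)
  have hD : ∫ u in Ioi (0:ℝ), rotD α θ x u = ((x ^ α : ℝ) : ℂ) * (x • ∫ s in Ioi (0:ℝ), rotF α 0 x θ s)
      - ((x ^ α : ℝ) : ℂ) * I := by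
    rw [← s3, ← hB, ← integral_const_mul, ← integral_const_mul,
      ← integral_sub (hint'.const_mul _) (hBi.const_mul _)]
    refine setIntegral_congr_fun measurableSet_Ioi fun u hu => ?_
    have hu' : (0:ℝ) < u := hu
    have hxC : (x : ℂ) ≠ 0 := by exact_mod_cast hx.ne'
    have e1 : (((x⁻¹ * u) ^ α : ℝ) : ℂ) = ((x ^ (-α) : ℝ) : ℂ) * ((u ^ α : ℝ) : ℂ) := by
      rw [← Complex.ofReal_mul, Real.mul_rpow (by positivity) hu'.le, Real.inv_rpow hx.le,
        Real.rpow_neg hx.le]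
    have e2 : I * (x : ℂ) * ((x⁻¹ * u : ℝ) : ℂ) = I * u := by
      push_cast; field_simp
    simp only [rotD, rotF]
    rw [e1, e2, Complex.exp_add]
    simp only [Complex.ofReal_zero, zero_add, mul_one, Real.rpow_zero, Complex.ofReal_one]
    rw [show -(((x ^ (-α) : ℝ) : ℂ) * ((u ^ α : ℝ) : ℂ)) * cexp (I * α * θ)
      = ((x ^ (-α) : ℝ) : ℂ) * (-((u ^ α : ℝ) : ℂ) * cexp (I * α * θ)) by ring]
    ring
  rw [s1, s2, hD, Complex.sub_re, Complex.re_ofReal_mul, Complex.re_ofReal_mul, Complex.I_re,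
    Complex.smul_re, Real.rpow_add hx, Real.rpow_one, smul_eq_mul]
  ring

lemma norm_rotD_le (α θ x u : ℝ) (hx : 0 < x) (hu : 0 < u) (hc : 0 ≤ Real.cos (α * θ)) :
    ‖rotD α θ x u‖ ≤ u ^ α * Real.exp (-Real.sin θ * u ^ (1:ℝ)) := by
  have h1 : I * (α : ℂ) * θ = ((α * θ : ℝ) : ℂ) * I := by push_cast; ring
  have h2 : I * (θ : ℂ) = (θ : ℂ) * I := by ring
  have hxα := Real.rpow_pos_of_pos hx α
  have hxα' := Real.rpow_pos_of_pos hx (-α)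
  have huα := Real.rpow_pos_of_pos hu α
  have n1 : ‖cexp (I * u * cexp (I * θ))‖ = Real.exp (-Real.sin θ * u ^ (1:ℝ)) := by
    rw [Complex.norm_exp, mul_assoc, Complex.I_mul_re, Complex.im_ofReal_mul, h2,
      Complex.exp_ofReal_mul_I_im, Real.rpow_one]
    congr 1; ring
  have n2 := norm_exp_sub_one_le_of_re
    (((x ^ (-α) : ℝ) : ℂ) * (-((u ^ α : ℝ) : ℂ) * cexp (I * α * θ))) (by
      rw [Complex.re_ofReal_mul, ← Complex.ofReal_neg, Complex.re_ofReal_mul, h1,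
        Complex.exp_ofReal_mul_I_re]
      have := mul_nonneg (mul_nonneg hxα'.le huα.le) hc
      nlinarith)
  have n3 : ‖((x ^ (-α) : ℝ) : ℂ) * (-((u ^ α : ℝ) : ℂ) * cexp (I * α * θ))‖
      = x ^ (-α) * u ^ α := by
    rw [norm_mul, norm_mul, norm_neg, h1, Complex.norm_exp_ofReal_mul_I, Complex.norm_real,
      Complex.norm_real, Real.norm_of_nonneg hxα'.le, Real.norm_of_nonneg huα.le, mul_one]
  rw [n3] at n2
  rw [rotD, norm_mul, norm_mul, norm_mul, n1, h2, Complex.norm_exp_ofReal_mul_I, one_mul,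
    Complex.norm_real, Real.norm_of_nonneg hxα.le]
  have : x ^ α * (x ^ (-α) * u ^ α) = u ^ α := by
    rw [← mul_assoc, ← Real.rpow_add hx, add_neg_cancel, Real.rpow_zero, one_mul]
  refine mul_le_mul_of_nonneg_right ?_ (Real.exp_pos _).le
  calc _ ≤ x ^ α * (x ^ (-α) * u ^ α) := mul_le_mul_of_nonneg_left n2 hxα.le
    _ = _ := this

lemma tendsto_rotD (α θ u : ℝ) (hα : 0 < α) :
    Tendsto (fun x => rotD α θ x u) atTop
      (𝓝 (-(cexp (I * (α + 1) * θ) * ((u ^ α : ℝ) : ℂ) * cexp (I * u * cexp (I * θ))))) := by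
  set w : ℂ := -((u ^ α : ℝ) : ℂ) * cexp (I * α * θ) with hw
  have hd : HasDerivAt (fun h : ℝ => cexp ((h : ℂ) * w)) w 0 := by
    have hid : HasDerivAt (fun s : ℝ => (s : ℂ)) 1 (0:ℝ) := Complex.ofRealCLM.hasDerivAt
    have := (hid.mul_const w).cexp
    simpa using this
  have ht : Tendsto (fun x : ℝ => x ^ (-α)) atTop (𝓝[≠] 0) := by
    refine tendsto_nhdsWithin_iff.2 ⟨tendsto_rpow_neg_atTop hα, ?_⟩
    filter_upwards [eventually_gt_atTop 0] with x hx
    exact (Real.rpow_pos_of_pos hx _).ne'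
  have h := hd.tendsto_slope_zero.comp ht
  have h' := (h.const_mul (cexp (I * θ))).mul_const (cexp (I * u * cexp (I * θ)))
  have hlim : cexp (I * θ) * w * cexp (I * u * cexp (I * θ))
      = -(cexp (I * (α + 1) * θ) * ((u ^ α : ℝ) : ℂ) * cexp (I * u * cexp (I * θ))) := by
    rw [show I * ((α : ℂ) + 1) * θ = I * α * θ + I * θ by ring, Complex.exp_add, hw]
    ring
  rw [hlim] at h'
  refine h'.congr' ?_
  filter_upwards [eventually_gt_atTop 0] with x hx
  simp only [Function.comp, rotD, zero_add, Complex.ofReal_zero, zero_mul, Complex.exp_zero,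
    Complex.real_smul]
  rw [Real.rpow_neg hx.le, inv_inv]

theorem stmt_7 (α : ℝ) (hα : 0 < α) :
    Filter.Tendsto
      (fun x : ℝ => x ^ (α + 1) *
        ∫ t in Set.Ioi (0 : ℝ), Real.exp (-(t ^ α)) * Real.cos (x * t))
      Filter.atTop
      (nhds (Real.Gamma (α + 1) * Real.sin (Real.pi * α / 2))) := by
  have hpi := Real.pi_pos
  obtain ⟨θ, h0, h1, h2⟩ : ∃ θ : ℝ, 0 < θ ∧ θ < Real.pi / 2 ∧ α * θ < Real.pi / 2 := by
    refine ⟨min (Real.pi / 4) (Real.pi / (4 * α)), by positivity, ?_, ?_⟩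
    · exact (min_le_left _ _).trans_lt (by linarith)
    · have := mul_le_mul_of_nonneg_left (min_le_right (Real.pi / 4) (Real.pi / (4 * α))) hα.le
      have e : α * (Real.pi / (4 * α)) = Real.pi / 4 := by field_simp
      linarith
  have hc : 0 < Real.cos (α * θ) :=
    Real.cos_pos_of_mem_Ioo ⟨by have := mul_pos hα h0; linarith [Real.pi_pos], h2⟩
  have hsin : 0 < Real.sin θ := Real.sin_pos_of_pos_of_lt_pi h0 (by linarith)
  have hlim : Tendsto (fun x => ∫ u in Ioi (0:ℝ), rotD α θ x u) atTop
      (𝓝 (∫ u in Ioi (0:ℝ), -(cexp (I * (α + 1) * θ) * ((u ^ α : ℝ) : ℂ) *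
        cexp (I * u * cexp (I * θ))))) := by
    refine tendsto_integral_filter_of_dominated_convergence
      (fun u => u ^ α * Real.exp (-Real.sin θ * u ^ (1:ℝ))) ?_ ?_
      (integrable_bd 1 α _ one_pos hα.le hsin) ?_
    · refine Eventually.of_forall fun x => Continuous.aestronglyMeasurable ?_
      have h1 : Continuous fun s : ℝ => s ^ α := Real.continuous_rpow_const hα.le
      unfold rotD
      fun_prop
    · filter_upwards [eventually_gt_atTop 0] with x hx
      filter_upwards [ae_restrict_mem measurableSet_Ioi] with u hu
      exact norm_rotD_le α θ x u hx hu hc.le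
    · exact Eventually.of_forall fun u => tendsto_rotD α θ u hα
  rw [integral_neg, gamma_rot α θ hα.le h0 h1] at hlim
  have hre := (Complex.continuous_re.tendsto _).comp hlim
  have hv : (-(cexp (I * (α + 1) * (Real.pi / 2)) * (Real.Gamma (α + 1) : ℝ))).re
      = Real.Gamma (α + 1) * Real.sin (Real.pi * α / 2) := by
    rw [show I * ((α : ℂ) + 1) * (Real.pi / 2)
      = ((Real.pi * α / 2 + Real.pi / 2 : ℝ) : ℂ) * I by push_cast; ring, Complex.neg_re,
      Complex.re_mul_ofReal, Complex.exp_ofReal_mul_I_re, Real.cos_add_pi_div_two]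
    ring
  rw [hv] at hre
  refine hre.congr' ?_
  filter_upwards [eventually_gt_atTop 0] with x hx
  exact (main_eq α θ x hα h0 h1 h2 hx).symm
end

section
/- (Kato's inequality on the torus) Let 1 < p < ∞ and d, d₁ ≥ 1. For every smooth ℤ^d-periodic function φ : ℝ^d → ℝ^{d₁}, one has −∫_{[0,1]^d} |φ|^{p−2} ⟨φ, Δφ⟩ dx ≥ min{1, p−1} · ∫_{[0,1]^d ∩ {φ ≠ 0}} |φ|^{p−2} |∇φ|² dx, where ⟨·,·⟩ is the Euclidean inner product on ℝ^{d₁}, Δφ is the componentwise Laplacian, |∇φ|² = ∑_{j=1}^{d₁} ∑_{k=1}^{d} (∂_k φ_j)², and the integrand |φ|^{p−2} ⟨φ, Δφ⟩ is interpreted as 0 at points where φ = 0 (it extends continuously there since p > 1). -/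
open MeasureTheory

/-- The unit cube `[0,1]^d`, a fundamental domain for `ℤ^d`-periodic functions. -/
def unitBox (d : ℕ) : Set (Fin d → ℝ) :=
  Set.univ.pi fun _ : Fin d => Set.Icc (0 : ℝ) 1

/-- The Laplacian `Δ g = ∑ k ∂²g/∂x_k²` of a scalar function on `ℝ^d`. -/
noncomputable def lapPi {d : ℕ} (g : (Fin d → ℝ) → ℝ) (x : Fin d → ℝ) : ℝ :=
  ∑ k : Fin d, iteratedFDeriv ℝ 2 g x ![Pi.single k (1 : ℝ), Pi.single k (1 : ℝ)]

lemma kato_div (n : ℕ) (F : Fin (n+1) → (Fin (n+1) → ℝ) → ℝ) (hF : ∀ k, ContDiff ℝ 1 (F k))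
    (hper : ∀ k (x : Fin (n+1) → ℝ) (m : Fin (n+1) → ℤ), F k (x + fun i => (m i : ℝ)) = F k x) :
    ∫ x in unitBox (n+1), ∑ k, fderiv ℝ (F k) x (Pi.single k 1) = 0 := by
  have hbox : unitBox (n+1) = Set.Icc (0 : Fin (n+1) → ℝ) 1 := by
    rw [← Set.pi_univ_Icc]; rfl
  rw [hbox]
  have h := integral_divergence_of_hasFDerivAt_off_countable' (E := ℝ) (n := n) (0 : Fin (n+1) → ℝ) 1
    (fun i => by simp) F (fun k x => fderiv ℝ (F k) x) ∅ Set.countable_empty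
    (fun k => (hF k).continuous.continuousOn)
    (fun x _ k => ((hF k).differentiable one_ne_zero x).hasFDerivAt) ?_
  · rw [h]
    apply Finset.sum_eq_zero
    intro i _
    rw [sub_eq_zero]
    congr 1
    ext x
    rw [← hper i (i.insertNth ((0 : Fin (n+1) → ℝ) i) x) (Pi.single i 1)]
    congr 1
    ext j
    rcases eq_or_ne j i with rfl | hj
    · simp
    · obtain ⟨j, rfl⟩ := Fin.exists_succAbove_eq hj
      simp [Pi.single_apply]
  · apply Continuous.integrableOn_Icc
    refine continuous_finsetSum _ fun k _ => ?_
    exact ((hF k).continuous_fderiv one_ne_zero).clm_apply continuous_const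

lemma kato_deriv {d d₁ : ℕ} (q ε : ℝ) (hε : 0 < ε) (ψ : Fin d₁ → (Fin d → ℝ) → ℝ)
    (g : Fin d₁ → (Fin d → ℝ) → ℝ) (e x : Fin d → ℝ)
    (hψ : ∀ j, Differentiable ℝ (ψ j)) (hg : ∀ j, Differentiable ℝ (g j))
    (hgψ : ∀ j, g j x = fderiv ℝ (ψ j) x e) :
    fderiv ℝ (fun y => (∑ j, ψ j y ^ 2 + ε) ^ q * ∑ j, ψ j y * g j y) x e =
      2 * q * (∑ j, ψ j x ^ 2 + ε) ^ (q - 1) * (∑ j, ψ j x * g j x) ^ 2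
      + (∑ j, ψ j x ^ 2 + ε) ^ q * ∑ j, g j x ^ 2
      + (∑ j, ψ j x ^ 2 + ε) ^ q * ∑ j, ψ j x * fderiv ℝ (g j) x e := by
  have hS : 0 < ∑ j, ψ j x ^ 2 + ε := by
    have : 0 ≤ ∑ j, ψ j x ^ 2 := Finset.sum_nonneg fun _ _ => sq_nonneg _
    linarith
  have h1 : HasFDerivAt (fun y => ∑ j, ψ j y ^ 2 + ε)
      (∑ j, (2 * ψ j x) • fderiv ℝ (ψ j) x) x := by
    refine HasFDerivAt.add_const _ (HasFDerivAt.fun_sum fun j _ => ?_)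
    simpa using (hψ j x).hasFDerivAt.pow 2
  have h2 := h1.rpow_const (p := q) (Or.inl hS.ne')
  have h3 : HasFDerivAt (fun y => ∑ j, ψ j y * g j y)
      (∑ j, (ψ j x • fderiv ℝ (g j) x + g j x • fderiv ℝ (ψ j) x)) x :=
    HasFDerivAt.fun_sum fun j _ => (hψ j x).hasFDerivAt.mul (hg j x).hasFDerivAt
  rw [(h2.fun_mul h3).fderiv]
  simp only [_root_.add_apply, _root_.smul_apply,
    _root_.sum_apply, smul_eq_mul, ← hgψ, Finset.sum_add_distrib]
  have : ∑ j, 2 * ψ j x * g j x = 2 * ∑ j, ψ j x * g j x := by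
    rw [Finset.mul_sum]; simp only [mul_assoc]
  rw [this]
  simp only [← sq]
  ring

lemma kato_pw {d₁ : ℕ} (p ε : ℝ) (hε : 0 < ε) (a b : Fin d₁ → ℝ) :
    min 1 (p - 1) * ((∑ j, a j ^ 2 + ε) ^ ((p-2)/2) * ∑ j, b j ^ 2) ≤
      2 * ((p-2)/2) * (∑ j, a j ^ 2 + ε) ^ ((p-2)/2 - 1) * (∑ j, a j * b j) ^ 2
      + (∑ j, a j ^ 2 + ε) ^ ((p-2)/2) * ∑ j, b j ^ 2 := by
  have hu : 0 ≤ ∑ j, a j ^ 2 := Finset.sum_nonneg fun _ _ => sq_nonneg _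
  have hb : 0 ≤ ∑ j, b j ^ 2 := Finset.sum_nonneg fun _ _ => sq_nonneg _
  have cs := Finset.sum_mul_sq_le_sq_mul_sq Finset.univ a b
  set S := ∑ j, a j ^ 2 + ε with hS
  have hS0 : 0 < S := by linarith
  have e : S ^ ((p-2)/2) = S ^ ((p-2)/2 - 1) * S := by
    rw [Real.rpow_sub_one hS0.ne']; field_simp
  have hw : 0 < S ^ ((p-2)/2 - 1) := Real.rpow_pos_of_pos hS0 _
  rw [e]
  set W := S ^ ((p-2)/2 - 1)
  set B := ∑ j, b j ^ 2
  set C := (∑ j, a j * b j) ^ 2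
  have hC0 : 0 ≤ C := sq_nonneg _
  have hC : C ≤ S * B := by nlinarith
  have h : min 1 (p-1) * (S * B) ≤ (p-2) * C + S * B := by
    have hSB : 0 ≤ S * B := by positivity
    rcases le_total 2 p with h | h
    · rw [min_eq_left (by linarith)]; nlinarith
    · rw [min_eq_right (by linarith)]; nlinarith
  nlinarith [mul_le_mul_of_nonneg_left h hw.le]

lemma kato_lap {d : ℕ} (g : (Fin d → ℝ) → ℝ) (hg : ContDiff ℝ (⊤ : ℕ∞) g) (x : Fin d → ℝ) :
    lapPi g x = ∑ k, fderiv ℝ (fun y => fderiv ℝ g y (Pi.single k (1:ℝ))) x (Pi.single k 1) := by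
  unfold lapPi
  refine Finset.sum_congr rfl fun k _ => ?_
  rw [iteratedFDeriv_two_apply]
  have h : Differentiable ℝ (fderiv ℝ g) :=
    (hg.fderiv_right (m := 1) (by norm_cast)).differentiable one_ne_zero
  rw [((h x).hasFDerivAt.clm_apply (hasFDerivAt_const (Pi.single k (1:ℝ)) x)).fderiv]
  simp

lemma kato_smooth {d : ℕ} (g : (Fin d → ℝ) → ℝ) (hg : ContDiff ℝ (⊤ : ℕ∞) g) (e : Fin d → ℝ) :
    ContDiff ℝ (⊤ : ℕ∞) (fun y => fderiv ℝ g y e) :=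
  (hg.fderiv_right (m := (⊤ : ℕ∞)) (by norm_cast)).clm_apply contDiff_const

lemma kato_lap_cont {d : ℕ} (g : (Fin d → ℝ) → ℝ) (hg : ContDiff ℝ (⊤ : ℕ∞) g) :
    Continuous (lapPi g) := by
  have : lapPi g = fun x =>
      ∑ k, fderiv ℝ (fun y => fderiv ℝ g y (Pi.single k (1:ℝ))) x (Pi.single k 1) :=
    funext (kato_lap g hg)
  rw [this]
  exact continuous_finsetSum _ fun k _ => (kato_smooth _ (kato_smooth g hg _) _).continuous

lemma unitBox_eq (d : ℕ) : unitBox d = Set.Icc (0 : Fin d → ℝ) 1 := by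
  rw [← Set.pi_univ_Icc]; rfl

lemma kato_S_pos {d₁ : ℕ} (a : Fin d₁ → ℝ) (ε : ℝ) (hε : 0 < ε) : 0 < ∑ j, a j ^ 2 + ε := by
  have : 0 ≤ ∑ j, a j ^ 2 := Finset.sum_nonneg fun _ _ => sq_nonneg _
  linarith

lemma kato_w_cont {d d₁ : ℕ} (q ε : ℝ) (hε : 0 < ε) (ψ : Fin d₁ → (Fin d → ℝ) → ℝ)
    (hψ : ∀ j, Continuous (ψ j)) : Continuous fun x => (∑ j, ψ j x ^ 2 + ε) ^ q := by
  refine Continuous.rpow_const (by fun_prop) fun x => Or.inl (kato_S_pos _ ε hε).ne'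

lemma kato_eps (n d₁ : ℕ) (p ε : ℝ) (hε : 0 < ε)
    (ψ : Fin d₁ → (Fin (n+1) → ℝ) → ℝ) (hψ : ∀ j, ContDiff ℝ (⊤ : ℕ∞) (ψ j))
    (hper : ∀ j (x : Fin (n+1) → ℝ) (m : Fin (n+1) → ℤ), ψ j (x + fun i => (m i : ℝ)) = ψ j x) :
    min 1 (p - 1) * (∫ x in unitBox (n+1), (∑ j, ψ j x ^ 2 + ε) ^ ((p-2)/2) *
        ∑ j, ∑ k, (fderiv ℝ (ψ j) x (Pi.single k (1:ℝ))) ^ 2) ≤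
      - ∫ x in unitBox (n+1), (∑ j, ψ j x ^ 2 + ε) ^ ((p-2)/2) * ∑ j, ψ j x * lapPi (ψ j) x := by
  set q := (p-2)/2 with hq
  let G : Fin d₁ → Fin (n+1) → (Fin (n+1) → ℝ) → ℝ :=
    fun j k x => fderiv ℝ (ψ j) x (Pi.single k (1:ℝ))
  have hG : ∀ j k, ContDiff ℝ (⊤ : ℕ∞) (G j k) := fun j k => kato_smooth _ (hψ j) _
  have hGper : ∀ j k (x : Fin (n+1) → ℝ) (m : Fin (n+1) → ℤ),
      G j k (x + fun i => (m i : ℝ)) = G j k x := by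
    intro j k x m
    have : (fun y => ψ j (y + fun i => (m i : ℝ))) = ψ j := funext fun y => hper j y m
    change fderiv ℝ (ψ j) (x + _) _ = fderiv ℝ (ψ j) x _
    rw [← fderiv_comp_add_right, this]
  let F : Fin (n+1) → (Fin (n+1) → ℝ) → ℝ := fun k y =>
    (∑ j, ψ j y ^ 2 + ε) ^ q * ∑ j, ψ j y * G j k y
  have hF : ∀ k, ContDiff ℝ 1 (F k) := by
    intro k
    have h1 : ∀ j, ContDiff ℝ 1 (ψ j) := fun j => (hψ j).of_le (by norm_cast)
    have h2 : ∀ j, ContDiff ℝ 1 (G j k) := fun j => (hG j k).of_le (by norm_cast)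
    refine ContDiff.mul (ContDiff.rpow_const_of_ne ?_ fun x => (kato_S_pos _ ε hε).ne') ?_
    · exact (ContDiff.sum fun j _ => (h1 j).pow 2).add contDiff_const
    · exact ContDiff.sum fun j _ => (h1 j).mul (h2 j)
  have hdiv := kato_div n F hF (fun k x m => by simp only [F, hper, hGper])
  have hψc : ∀ j, Continuous (ψ j) := fun j => (hψ j).continuous
  have hGc : ∀ j k, Continuous (G j k) := fun j k => (hG j k).continuous
  have hwc := kato_w_cont q ε hε ψ hψc
  have hA : Continuous fun x => (∑ j, ψ j x ^ 2 + ε) ^ q * ∑ j, ∑ k, G j k x ^ 2 :=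
    hwc.mul (by fun_prop)
  have hB : Continuous fun x => (∑ j, ψ j x ^ 2 + ε) ^ q * ∑ j, ψ j x * lapPi (ψ j) x :=
    hwc.mul (continuous_finsetSum _ fun j _ => (hψc j).mul (kato_lap_cont _ (hψ j)))
  have hD : Continuous fun x => ∑ k, fderiv ℝ (F k) x (Pi.single k 1) :=
    continuous_finsetSum _ fun k _ =>
      ((hF k).continuous_fderiv one_ne_zero).clm_apply continuous_const
  have key : ∀ x, min 1 (p-1) * ((∑ j, ψ j x ^ 2 + ε) ^ q * ∑ j, ∑ k, G j k x ^ 2) ≤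
      ∑ k, fderiv ℝ (F k) x (Pi.single k 1)
        - (∑ j, ψ j x ^ 2 + ε) ^ q * ∑ j, ψ j x * lapPi (ψ j) x := by
    intro x
    have e1 : ∀ k, _ := fun k => kato_deriv q ε hε ψ (fun j => G j k) (Pi.single k 1) x
      (fun j => (hψ j).differentiable (by simp)) (fun j => (hG j k).differentiable (by simp))
      (fun j => rfl)
    simp only [F]
    rw [Finset.sum_congr rfl fun k _ => e1 k]
    have e2 : ∑ j, ψ j x * lapPi (ψ j) x =
        ∑ k, ∑ j, ψ j x * fderiv ℝ (G j k) x (Pi.single k 1) := by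
      rw [Finset.sum_comm]
      refine Finset.sum_congr rfl fun j _ => ?_
      rw [kato_lap _ (hψ j), Finset.mul_sum]
    rw [e2, Finset.sum_comm, Finset.mul_sum, Finset.mul_sum, Finset.mul_sum,
      Finset.sum_add_distrib, add_sub_cancel_right]
    exact Finset.sum_le_sum fun k _ => kato_pw p ε hε (fun j => ψ j x) (fun j => G j k x)
  rw [unitBox_eq] at *
  have := integral_mono (μ := volume.restrict (Set.Icc (0 : Fin (n+1) → ℝ) 1))
    ((hA.integrableOn_Icc).const_mul (min 1 (p-1)))
    (hD.integrableOn_Icc.sub hB.integrableOn_Icc) key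
  rw [integral_const_mul] at this
  refine this.trans ?_
  rw [integral_sub' hD.integrableOn_Icc hB.integrableOn_Icc, hdiv, zero_sub]

lemma kato_sqrt (u p : ℝ) (hu : 0 ≤ u) : Real.sqrt u ^ (p-2) = u ^ ((p-2)/2) := by
  rw [Real.sqrt_eq_rpow, ← Real.rpow_mul hu]; congr 1; ring

open Filter Topology in
lemma kato_fatou {α : Type*} [MeasurableSpace α] (μ ν : Measure α) (hνμ : ν ≤ μ) (f : α → ℝ)
    (fn : ℕ → α → ℝ) (R : ℕ → ℝ) (R0 c : ℝ) (hc : 0 < c)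
    (hfn : ∀ n x, 0 ≤ fn n x) (hf : ∀ x, 0 ≤ f x) (hint : ∀ n, Integrable (fn n) μ)
    (hR : ∀ n, c * ∫ x, fn n x ∂μ ≤ R n) (hlimR : Tendsto R atTop (𝓝 R0))
    (hlim : ∀ᵐ x ∂ν, Tendsto (fun n => fn n x) atTop (𝓝 (f x))) :
    c * ∫ x, f x ∂ν ≤ R0 := by
  have hR0 : 0 ≤ R0 := ge_of_tendsto' hlimR fun n =>
    (mul_nonneg hc.le (integral_nonneg (hfn n))).trans (hR n)
  rw [← le_div_iff₀' hc]
  have hint' : ∀ n, Integrable (fn n) ν := fun n => (hint n).mono_measure hνμ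
  have hmeas : AEStronglyMeasurable f ν :=
    aestronglyMeasurable_of_tendsto_ae atTop (fun n => (hint' n).1) hlim
  rw [integral_eq_lintegral_of_nonneg_ae (Eventually.of_forall hf) hmeas]
  refine ENNReal.toReal_le_of_le_ofReal (by positivity) ?_
  have h1 : ∫⁻ x, ENNReal.ofReal (f x) ∂ν =
      ∫⁻ x, liminf (fun n => ENNReal.ofReal (fn n x)) atTop ∂ν := by
    refine lintegral_congr_ae ?_
    filter_upwards [hlim] with x hx
    exact ((ENNReal.continuous_ofReal.tendsto _).comp hx).liminf_eq.symm
  rw [h1]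
  refine (lintegral_liminf_le' fun n => (hint' n).1.aemeasurable.ennreal_ofReal).trans ?_
  have h2 : Tendsto (fun n => ENNReal.ofReal (R n / c)) atTop (𝓝 (ENNReal.ofReal (R0 / c))) :=
    (ENNReal.continuous_ofReal.tendsto _).comp (hlimR.div_const c)
  rw [← h2.liminf_eq]
  refine liminf_le_liminf (Eventually.of_forall fun n => ?_)
  refine (lintegral_mono' hνμ le_rfl).trans ?_
  rw [← ofReal_integral_eq_lintegral_ofReal (hint n) (Eventually.of_forall (hfn n))]
  exact ENNReal.ofReal_le_ofReal ((le_div_iff₀' hc).2 (hR n))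

/-- Domination of the regularised integrand. -/
lemma kato_dom {d₁ : ℕ} (p ε : ℝ) (hp : 1 < p) (hε : 0 < ε) (hε1 : ε ≤ 1) (a l : Fin d₁ → ℝ) :
    |(∑ j, a j ^ 2 + ε) ^ ((p-2)/2) * ∑ j, a j * l j| ≤
      (∑ j, a j ^ 2 + 1) ^ ((p-1)/2) * ∑ j, |l j| := by
  have hS := kato_S_pos a ε hε
  have hu : 0 ≤ ∑ j, a j ^ 2 := Finset.sum_nonneg fun _ _ => sq_nonneg _
  have h1 : |∑ j, a j * l j| ≤ (∑ j, a j ^ 2 + ε) ^ ((1:ℝ)/2) * ∑ j, |l j| := by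
    refine (Finset.abs_sum_le_sum_abs _ _).trans ?_
    rw [Finset.mul_sum]
    refine Finset.sum_le_sum fun j _ => ?_
    rw [abs_mul]
    refine mul_le_mul_of_nonneg_right ?_ (abs_nonneg _)
    rw [← Real.sqrt_eq_rpow]
    refine Real.abs_le_sqrt ?_
    have := Finset.single_le_sum (f := fun j => a j ^ 2) (fun _ _ => sq_nonneg _)
      (Finset.mem_univ j)
    linarith
  rw [abs_mul, abs_of_pos (Real.rpow_pos_of_pos hS _)]
  refine (mul_le_mul_of_nonneg_left h1 (Real.rpow_pos_of_pos hS _).le).trans ?_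
  rw [← mul_assoc, ← Real.rpow_add hS]
  have : (p-2)/2 + 1/2 = (p-1)/2 := by ring
  rw [this]
  refine mul_le_mul_of_nonneg_right ?_ (Finset.sum_nonneg fun _ _ => abs_nonneg _)
  exact Real.rpow_le_rpow hS.le (by linarith) (by linarith)

open Filter Topology in
lemma kato_tendsto (u q : ℝ) (hu : 0 < u) :
    Tendsto (fun n : ℕ => (u + 1 / ((n : ℝ) + 1)) ^ q) atTop (𝓝 (u ^ q)) := by
  have h : Tendsto (fun n : ℕ => u + 1 / ((n : ℝ) + 1)) atTop (𝓝 u) := by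
    simpa using (tendsto_one_div_add_atTop_nhds_zero_nat (𝕜 := ℝ)).const_add u
  exact h.rpow_const (Or.inl hu.ne')

theorem stmt_17 (d d₁ : ℕ) (hd : 1 ≤ d) (hd₁ : 1 ≤ d₁) (p : ℝ) (hp : 1 < p)
    (φ : (Fin d → ℝ) → (Fin d₁ → ℝ)) (hφ : ContDiff ℝ (⊤ : ℕ∞) φ)
    (hper : ∀ (x : Fin d → ℝ) (k : Fin d → ℤ), φ (x + fun i => (k i : ℝ)) = φ x) :
    min 1 (p - 1) *
        (∫ x in unitBox d ∩ {x | φ x ≠ 0},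
          (Real.sqrt (∑ j, φ x j ^ 2)) ^ (p - 2) *
            ∑ j, ∑ k, (fderiv ℝ (fun y => φ y j) x (Pi.single k (1 : ℝ))) ^ 2)
      ≤ -∫ x in unitBox d,
          (Real.sqrt (∑ j, φ x j ^ 2)) ^ (p - 2) *
            ∑ j, φ x j * lapPi (fun y => φ y j) x := by
  obtain ⟨n, rfl⟩ : ∃ n, d = n + 1 := ⟨d - 1, by omega⟩
  have hψ : ∀ j, ContDiff ℝ (⊤ : ℕ∞) (fun y => φ y j) := contDiff_pi.1 hφ
  have hψc : ∀ j, Continuous (fun y => φ y j) := fun j => (hψ j).continuous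
  have hu : ∀ x, 0 ≤ ∑ j, φ x j ^ 2 := fun x => Finset.sum_nonneg fun _ _ => sq_nonneg _
  have hupos : ∀ x, φ x ≠ 0 → 0 < ∑ j, φ x j ^ 2 := by
    intro x hx
    obtain ⟨j, hj⟩ := Function.ne_iff.1 hx
    exact Finset.sum_pos' (fun _ _ => sq_nonneg _) ⟨j, Finset.mem_univ j, by
      have : φ x j ≠ 0 := hj
      positivity⟩
  have hε : ∀ m : ℕ, (0:ℝ) < 1 / ((m : ℝ) + 1) := fun m => by positivity
  have hε1 : ∀ m : ℕ, 1 / ((m : ℝ) + 1) ≤ 1 := fun m => by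
    rw [div_le_one (by positivity)]; linarith [(Nat.cast_nonneg m : (0:ℝ) ≤ m)]
  simp only [kato_sqrt _ p (hu _)]
  refine kato_fatou (volume.restrict (unitBox (n+1)))
    (volume.restrict (unitBox (n+1) ∩ {x | φ x ≠ 0}))
    (Measure.restrict_mono Set.inter_subset_left le_rfl) _
    (fun m x => (∑ j, φ x j ^ 2 + 1 / ((m : ℝ) + 1)) ^ ((p-2)/2) *
            ∑ j, ∑ k, (fderiv ℝ (fun y => φ y j) x (Pi.single k (1 : ℝ))) ^ 2)
    (fun m => - ∫ x in unitBox (n+1), (∑ j, φ x j ^ 2 + 1 / ((m : ℝ) + 1)) ^ ((p-2)/2) *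
      ∑ j, φ x j * lapPi (fun y => φ y j) x) _ _ (lt_min one_pos (by linarith)) ?_ ?_ ?_ ?_ ?_ ?_
  · intro m x
    exact mul_nonneg (Real.rpow_pos_of_pos (kato_S_pos _ _ (hε m)) _).le
      (Finset.sum_nonneg fun _ _ => Finset.sum_nonneg fun _ _ => sq_nonneg _)
  · intro x
    exact mul_nonneg (Real.rpow_nonneg (hu x) _)
      (Finset.sum_nonneg fun _ _ => Finset.sum_nonneg fun _ _ => sq_nonneg _)
  · intro m
    rw [unitBox_eq]
    refine Continuous.integrableOn_Icc ?_
    refine (kato_w_cont _ _ (hε m) (fun j y => φ y j) hψc).mul ?_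
    exact continuous_finsetSum _ fun j _ => continuous_finsetSum _ fun k _ =>
      (kato_smooth _ (hψ j) _).continuous.pow 2
  · intro m
    exact kato_eps n d₁ p _ (hε m) (fun j y => φ y j) hψ (fun j x k => by simp only [hper])
  · refine Filter.Tendsto.neg ?_
    refine tendsto_integral_of_dominated_convergence
      (fun x => (∑ j, φ x j ^ 2 + 1) ^ ((p-1)/2) * ∑ j, |lapPi (fun y => φ y j) x|) ?_ ?_ ?_ ?_
    · intro m
      refine Continuous.aestronglyMeasurable ?_
      exact (kato_w_cont _ _ (hε m) (fun j y => φ y j) hψc).mul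
        (continuous_finsetSum _ fun j _ => (hψc j).mul (kato_lap_cont _ (hψ j)))
    · rw [unitBox_eq]
      refine Continuous.integrableOn_Icc ?_
      exact (kato_w_cont _ _ one_pos (fun j y => φ y j) hψc).mul
        (continuous_finsetSum _ fun j _ => (kato_lap_cont _ (hψ j)).abs)
    · intro m
      refine Filter.Eventually.of_forall fun x => ?_
      exact kato_dom p _ hp (hε m) (hε1 m) (φ x) _
    · refine Filter.Eventually.of_forall fun x => ?_
      by_cases hx : φ x = 0
      · simp [hx]
      · exact (kato_tendsto _ _ (hupos x hx)).mul_const _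
  · have hopen : MeasurableSet {x | φ x ≠ 0} :=
      (isOpen_ne_fun hφ.continuous continuous_const).measurableSet
    have hm : MeasurableSet (unitBox (n+1) ∩ {x | φ x ≠ 0}) := by
      rw [unitBox_eq]; exact measurableSet_Icc.inter hopen
    refine (ae_restrict_iff' hm).2 (Filter.Eventually.of_forall fun x hx => ?_)
    exact (kato_tendsto _ _ (hupos x hx.2)).mul_const _
end
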